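/- Fix c > 0 and let f(n) = ⌈c·n^{3/2}⌉. Then for every activator sequence V on G(f), the upper burning density satisfies δ̄(G(f),V) ≤ (1+√6·c)^{-2}. -/

import Mathlib

open Filter Asymptotics

/-- Membership in the grid `[-f n, f n]^2 ⊆ ℤ × ℤ`. -/
def inGrid (f : ℕ → ℕ) (n : ℕ) (p : ℤ × ℤ) : Prop :=
  |p.1| ≤ (f n : ℤ) ∧ |p.2| ≤ (f n : ℤ)

instance (f : ℕ → ℕ) (n : ℕ) : DecidablePred (inGrid f n) := fun _ => by
  unfold inGrid; infer_instance

/-- The four lattice neighbours (at `L¹`-distance one) of a point. -/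
def nbrs (p : ℤ × ℤ) : Finset (ℤ × ℤ) :=
  {(p.1 + 1, p.2), (p.1 - 1, p.2), (p.1, p.2 + 1), (p.1, p.2 - 1)}

/-- An activator sequence: whenever `V n ≠ ∅` (for `n ≥ 1`), the activated vertex
lies in the grid at time `n`. -/
def IsActivator (f : ℕ → ℕ) (V : ℕ → Option (ℤ × ℤ)) : Prop :=
  ∀ n, 1 ≤ n → ∀ p, V n = some p → inGrid f n p

/-- The burning process: `B 0 = ∅`, and `B n` is obtained from `B (n-1)` by adding all
vertices of the grid at time `n` adjacent to a vertex of `B (n-1)`, and then adding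
the activator `V n` if it is not `∅`. -/
def burnSet (f : ℕ → ℕ) (V : ℕ → Option (ℤ × ℤ)) : ℕ → Finset (ℤ × ℤ)
  | 0 => ∅
  | n + 1 =>
    let B := burnSet f V n
    let spread := B ∪ (B.biUnion nbrs).filter (inGrid f (n + 1))
    match V (n + 1) with
    | none => spread
    | some v => insert v spread

/-- The proportion `|B n| / |V(G n)|` of burning vertices at time `n`. -/
noncomputable def densitySeq (f : ℕ → ℕ) (V : ℕ → Option (ℤ × ℤ)) (n : ℕ) : ℝ :=
  ((burnSet f V n).card : ℝ) / (2 * (f n : ℝ) + 1) ^ 2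

/-- The lower burning density `δ̲(G(f), V)`. -/
noncomputable def lowerDensity (f : ℕ → ℕ) (V : ℕ → Option (ℤ × ℤ)) : ℝ :=
  liminf (densitySeq f V) atTop

/-- The upper burning density `δ̄(G(f), V)`. -/
noncomputable def upperDensity (f : ℕ → ℕ) (V : ℕ → Option (ℤ × ℤ)) : ℝ :=
  limsup (densitySeq f V) atTop

/-- The burning density of `V` in `G(f)` exists and equals `ρ`. -/
def HasBurningDensity (f : ℕ → ℕ) (V : ℕ → Option (ℤ × ℤ)) (ρ : ℝ) : Prop :=
  Tendsto (densitySeq f V) atTop (nhds ρ)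

/-- `P(G(f))`: the set of `ρ ∈ [0,1]` achievable as the burning density of some
non-empty activator sequence. -/
def densSet (f : ℕ → ℕ) : Set ℝ :=
  {ρ | ρ ∈ Set.Icc (0 : ℝ) 1 ∧
    ∃ V : ℕ → Option (ℤ × ℤ), IsActivator f V ∧ (∃ t, 1 ≤ t ∧ V t ≠ none) ∧
      HasBurningDensity f V ρ}

/-- The controlled growth requirement. -/
def ControlledGrowth (f : ℕ → ℕ) : Prop :=
  (∀ᶠ n in atTop, f n < f (n + 1)) ∧
  (∀ ε : ℕ → ℕ, (fun n => (ε n : ℝ)) =o[atTop] (fun n => (n : ℝ)) →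
    Tendsto (fun n => (f (n + ε n) : ℝ) / (f n : ℝ)) atTop (nhds 1)) ∧
  (∀ c : ℝ, 0 < c → ∃ d : ℝ, 0 < d ∧
    ∀ᶠ n in atTop, (1 + d) * (f n : ℝ) ≤ (f (n + ⌈c * n⌉₊) : ℝ))

/-- The `L¹`-ball of radius `j` about `v`, as the union of its two parity classes. -/
def diamond (v : ℤ × ℤ) (j : ℕ) : Finset (ℤ × ℤ) :=
  (Finset.range (j + 1) ×ˢ Finset.range (j + 1)).image
      (fun q => (v.1 + q.1 - q.2, v.2 + q.1 + q.2 - j)) ∪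
    (Finset.range j ×ˢ Finset.range j).image
      (fun q => (v.1 + q.1 - q.2, v.2 + q.1 + q.2 - j + 1))

lemma card_diamond_le (v : ℤ × ℤ) (j : ℕ) :
    (diamond v j).card ≤ (j + 1) ^ 2 + j ^ 2 := by
  refine (Finset.card_union_le _ _).trans (add_le_add ?_ ?_) <;>
    refine Finset.card_image_le.trans ?_ <;> simp [sq]

lemma mem_diamond_of_le {v p : ℤ × ℤ} {j : ℕ}
    (h : |p.1 - v.1| + |p.2 - v.2| ≤ j) : p ∈ diamond v j := by
  obtain ⟨x, y⟩ := p
  obtain ⟨a, b⟩ := v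
  simp only [diamond, Finset.mem_union, Finset.mem_image, Finset.mem_product,
    Finset.mem_range, Prod.exists, Prod.mk.injEq] at h ⊢
  have h1 := le_abs_self (x - a)
  have h2 := neg_abs_le (x - a)
  have h3 := le_abs_self (y - b)
  have h4 := neg_abs_le (y - b)
  rcases Int.emod_two_eq_zero_or_one ((x - a) + (y - b) + j) with h5 | h5
  · left
    refine ⟨(((x - a) + (y - b) + j) / 2).toNat, (((y - b) - (x - a) + j) / 2).toNat, ?_⟩
    omega
  · right
    refine ⟨(((x - a) + (y - b) + j) / 2).toNat, (((y - b) - (x - a) + j) / 2).toNat, ?_⟩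
    omega

lemma mem_burnSet_succ {f : ℕ → ℕ} {V : ℕ → Option (ℤ × ℤ)} {n : ℕ} {p : ℤ × ℤ}
    (hp : p ∈ burnSet f V (n + 1)) :
    V (n + 1) = some p ∨ p ∈ burnSet f V n ∨
      (inGrid f (n + 1) p ∧ ∃ q ∈ burnSet f V n, p ∈ nbrs q) := by
  rw [burnSet] at hp
  cases hv : V (n + 1) with
  | none => simp [hv] at hp; grind
  | some v => simp [hv] at hp; grind

lemma inGrid_of_mem_burnSet {f : ℕ → ℕ} {V : ℕ → Option (ℤ × ℤ)} (hmono : Monotone f)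
    (hV : IsActivator f V) : ∀ {n : ℕ} {p : ℤ × ℤ}, p ∈ burnSet f V n → inGrid f n p
  | 0, p, hp => by simp [burnSet] at hp
  | n + 1, p, hp => by
    rcases mem_burnSet_succ hp with h | h | h
    · exact hV _ (by omega) _ h
    · have h1 := inGrid_of_mem_burnSet hmono hV h
      have h2 : (f n : ℤ) ≤ f (n + 1) := by exact_mod_cast hmono n.le_succ
      exact ⟨h1.1.trans h2, h1.2.trans h2⟩
    · exact h.1

/-- After `k` further steps, a vertex burning at time `m + k` is near the grid of time `m` or
close to an activator placed after time `m`. -/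
lemma mem_burnSet_add {f : ℕ → ℕ} {V : ℕ → Option (ℤ × ℤ)} (hmono : Monotone f)
    (hV : IsActivator f V) (m : ℕ) : ∀ (k : ℕ) {p : ℤ × ℤ}, p ∈ burnSet f V (m + k) →
      (|p.1| ≤ (f m : ℤ) + k ∧ |p.2| ≤ (f m : ℤ) + k) ∨
      ∃ j < k, ∃ v, V (m + k - j) = some v ∧ |p.1 - v.1| + |p.2 - v.2| ≤ (j : ℤ)
  | 0, p, hp => by
    left
    simpa [inGrid] using inGrid_of_mem_burnSet hmono hV hp
  | k + 1, p, hp => by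
    have step : ∀ q ∈ burnSet f V (m + k), |p.1 - q.1| + |p.2 - q.2| ≤ 1 →
        (|p.1| ≤ (f m : ℤ) + (k + 1 : ℕ) ∧ |p.2| ≤ (f m : ℤ) + (k + 1 : ℕ)) ∨
        ∃ j < k + 1, ∃ v, V (m + (k + 1) - j) = some v ∧
          |p.1 - v.1| + |p.2 - v.2| ≤ (j : ℤ) := by
      intro q hq hpq
      rcases mem_burnSet_add hmono hV m k hq with h | ⟨j, hj, v, hv, h⟩
      · left
        push_cast
        constructor <;> grind
      · right
        refine ⟨j + 1, by omega, v, ?_, ?_⟩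
        · rw [← hv]; congr 1; omega
        · have h1 := abs_sub_le p.1 q.1 v.1
          have h2 := abs_sub_le p.2 q.2 v.2
          push_cast
          linarith
    rcases mem_burnSet_succ hp with h | h | ⟨-, q, hq, h⟩
    · right
      exact ⟨0, by omega, p, by simpa [← add_assoc] using h, by simp⟩
    · exact step p h (by simp)
    · refine step q hq ?_
      simp only [nbrs, Finset.mem_insert, Finset.mem_singleton] at h
      rcases h with h | h | h | h <;> simp [h]

lemma sum_card_diamond_bound (k : ℕ) :
    (∑ j ∈ Finset.range k, ((j + 1) ^ 2 + j ^ 2 : ℝ)) = (2 * (k : ℝ) ^ 3 + k) / 3 := by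
  induction k with
  | zero => simp
  | succ k ih => rw [Finset.sum_range_succ, ih]; push_cast; ring

lemma card_burnSet_add_le {f : ℕ → ℕ} {V : ℕ → Option (ℤ × ℤ)} (hmono : Monotone f)
    (hV : IsActivator f V) (m k : ℕ) :
    ((burnSet f V (m + k)).card : ℝ) ≤
      (2 * ((f m : ℝ) + k) + 1) ^ 2 + (2 * (k : ℝ) ^ 3 + k) / 3 := by
  set I : Finset ℤ := Finset.Icc (-((f m : ℤ) + k)) ((f m : ℤ) + k) with hI
  have hsub : burnSet f V (m + k) ⊆ I ×ˢ I ∪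
      (Finset.range k).biUnion fun j => diamond ((V (m + k - j)).getD 0) j := by
    intro p hp
    rcases mem_burnSet_add hmono hV m k hp with h | ⟨j, hj, v, hv, h⟩
    · refine Finset.mem_union_left _ ?_
      simp only [hI, Finset.mem_product, Finset.mem_Icc]
      exact ⟨abs_le.1 h.1, abs_le.1 h.2⟩
    · refine Finset.mem_union_right _ (Finset.mem_biUnion.2 ⟨j, Finset.mem_range.2 hj, ?_⟩)
      rw [hv]
      exact mem_diamond_of_le h
  have hIc : I.card = 2 * (f m + k) + 1 := by
    rw [hI, Int.card_Icc]; omega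
  have hcard : (burnSet f V (m + k)).card ≤
      (2 * (f m + k) + 1) ^ 2 + ∑ j ∈ Finset.range k, ((j + 1) ^ 2 + j ^ 2) := by
    refine (Finset.card_le_card hsub).trans ((Finset.card_union_le _ _).trans (add_le_add ?_ ?_))
    · rw [Finset.card_product, hIc, sq]
    · exact Finset.card_biUnion_le.trans (Finset.sum_le_sum fun j _ => card_diamond_le _ _)
  rw [← sum_card_diamond_bound]
  exact_mod_cast hcard

lemma monotone_ceil_mul_rpow {c : ℝ} (hc : 0 < c) {f : ℕ → ℕ}
    (hf : ∀ n, f n = ⌈c * (n : ℝ) ^ ((3 : ℝ) / 2)⌉₊) : Monotone f := by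
  intro a b hab
  rw [hf, hf]
  gcongr

lemma natCast_rpow_three_halves_sq (n : ℕ) : ((n : ℝ) ^ ((3 : ℝ) / 2)) ^ 2 = (n : ℝ) ^ 3 := by
  rw [← Real.rpow_natCast, ← Real.rpow_mul n.cast_nonneg, ← Real.rpow_natCast]
  norm_num

/-- Splitting time at `t * n`, the counting bound has an explicit limiting density. -/
lemma tendsto_split_bound {c t : ℝ} (hc : 0 < c) (ht : 0 < t) (ht1 : t ≤ 1) {f : ℕ → ℕ}
    (hf : ∀ n, f n = ⌈c * (n : ℝ) ^ ((3 : ℝ) / 2)⌉₊) :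
    Tendsto (fun n : ℕ => ((2 * ((f ⌊t * n⌋₊ : ℝ) + (n - ⌊t * n⌋₊ : ℕ)) + 1) ^ 2 +
        (2 * ((n - ⌊t * n⌋₊ : ℕ) : ℝ) ^ 3 + (n - ⌊t * n⌋₊ : ℕ)) / 3) / (2 * (f n : ℝ) + 1) ^ 2)
      atTop (nhds (t ^ 3 + (1 - t) ^ 3 / (6 * c ^ 2))) := by
  have hs : Tendsto (fun n : ℕ => (n : ℝ) ^ ((3 : ℝ) / 2)) atTop atTop :=
    (tendsto_rpow_atTop (by norm_num)).comp tendsto_natCast_atTop_atTop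
  have hF : Tendsto (fun n : ℕ => (f n : ℝ) / (n : ℝ) ^ ((3 : ℝ) / 2)) atTop (nhds c) := by
    simp only [hf]
    exact (tendsto_nat_ceil_mul_div_atTop hc.le).comp hs
  have hm : Tendsto (fun n : ℕ => ((⌊t * n⌋₊ : ℕ) : ℝ) / n) atTop (nhds t) :=
    (tendsto_nat_floor_mul_div_atTop ht.le).comp tendsto_natCast_atTop_atTop
  have hmtop : Tendsto (fun n : ℕ => ⌊t * n⌋₊) atTop atTop :=
    tendsto_nat_floor_atTop.comp (tendsto_natCast_atTop_atTop.const_mul_atTop ht)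
  have hle : ∀ n : ℕ, ⌊t * n⌋₊ ≤ n := fun n =>
    Nat.floor_le_of_le (mul_le_of_le_one_left n.cast_nonneg ht1)
  have hFm : Tendsto (fun n : ℕ => (f ⌊t * n⌋₊ : ℝ) / (n : ℝ) ^ ((3 : ℝ) / 2)) atTop
      (nhds (c * t ^ ((3 : ℝ) / 2))) := by
    refine Tendsto.congr' ?_ ((hF.comp hmtop).mul (hm.rpow_const (p := 3 / 2) (Or.inl ht.ne')))
    filter_upwards [hmtop.eventually_gt_atTop 0] with n hn
    have hn' : (0 : ℝ) < (⌊t * n⌋₊ : ℕ) := by exact_mod_cast hn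
    have := Real.rpow_pos_of_pos hn' (3 / 2)
    simp only [Function.comp_apply]
    rw [Real.div_rpow (Nat.cast_nonneg _) (Nat.cast_nonneg _)]
    field_simp
  have hk : Tendsto (fun n : ℕ => ((n - ⌊t * n⌋₊ : ℕ) : ℝ) / n) atTop (nhds (1 - t)) := by
    refine Tendsto.congr' ?_ (hm.const_sub 1)
    filter_upwards [eventually_gt_atTop 0] with n hn
    have hn' : (n : ℝ) ≠ 0 := by exact_mod_cast hn.ne'
    rw [Nat.cast_sub (hle n), sub_div, div_self hn']
  have hinv : Tendsto (fun n : ℕ => ((n : ℝ) ^ ((3 : ℝ) / 2))⁻¹) atTop (nhds 0) :=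
    tendsto_inv_atTop_zero.comp hs
  have hninv : Tendsto (fun n : ℕ => (n : ℝ)⁻¹) atTop (nhds 0) :=
    tendsto_inv_atTop_nhds_zero_nat
  have hroot : Tendsto (fun n : ℕ => (n : ℝ) / (n : ℝ) ^ ((3 : ℝ) / 2)) atTop (nhds 0) := by
    refine Tendsto.congr' ?_ ((tendsto_rpow_neg_atTop (y := 1 / 2) (by norm_num)).comp
      tendsto_natCast_atTop_atTop)
    filter_upwards [eventually_gt_atTop 0] with n hn
    have hn' : (0 : ℝ) < n := by exact_mod_cast hn
    have h := Real.rpow_sub hn' 1 (3 / 2)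
    rw [Real.rpow_one] at h
    rw [← h, Function.comp_apply]
    norm_num
  have hmain := (((((hFm.add (hk.mul hroot)).const_mul 2).add hinv).pow 2).add
    ((((hk.pow 3).const_mul 2).add (hk.mul (hninv.pow 2))).div_const 3)).div
    (((hF.const_mul 2).add hinv).pow 2) (by positivity)
  have hlim : ((2 * (c * t ^ ((3 : ℝ) / 2) + (1 - t) * 0) + 0) ^ 2 +
      (2 * (1 - t) ^ 3 + (1 - t) * 0 ^ 2) / 3) / (2 * c + 0) ^ 2 =
      t ^ 3 + (1 - t) ^ 3 / (6 * c ^ 2) := by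
    have h : (t ^ ((3 : ℝ) / 2)) ^ 2 = t ^ 3 := by
      rw [← Real.rpow_natCast, ← Real.rpow_mul ht.le, ← Real.rpow_natCast]
      norm_num
    rw [← h]
    field_simp
    ring
  rw [hlim] at hmain
  refine hmain.congr' ?_
  filter_upwards [eventually_gt_atTop 0] with n hn
  have hn' : (0 : ℝ) < n := by exact_mod_cast hn
  have hsn := Real.rpow_pos_of_pos hn' (3 / 2)
  have hsq := natCast_rpow_three_halves_sq n
  simp only [Pi.div_apply]
  generalize (n : ℝ) ^ ((3 : ℝ) / 2) = s at *
  generalize ((n - ⌊t * n⌋₊ : ℕ) : ℝ) = k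
  have hnum : (2 * ((f ⌊t * n⌋₊ : ℝ) / s + k / n * (n / s)) + s⁻¹) ^ 2 +
      (2 * (k / n) ^ 3 + k / n * (n : ℝ)⁻¹ ^ 2) / 3 =
      ((2 * ((f ⌊t * n⌋₊ : ℝ) + k) + 1) ^ 2 + (2 * k ^ 3 + k) / 3) / s ^ 2 := by
    have h1 : (2 * (k / n) ^ 3 + k / n * (n : ℝ)⁻¹ ^ 2) / 3 = (2 * k ^ 3 + k) / 3 / s ^ 2 := by
      rw [hsq]
      field_simp
    rw [h1]
    field_simp
  have hden : (2 * ((f n : ℝ) / s) + s⁻¹) ^ 2 = (2 * (f n : ℝ) + 1) ^ 2 / s ^ 2 := by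
    field_simp
  rw [hnum, hden, div_div_div_cancel_right₀ (by positivity)]

lemma upperDensity_le_of_split {c t : ℝ} (hc : 0 < c) (ht : 0 < t) (ht1 : t ≤ 1) {f : ℕ → ℕ}
    (hf : ∀ n, f n = ⌈c * (n : ℝ) ^ ((3 : ℝ) / 2)⌉₊)
    {V : ℕ → Option (ℤ × ℤ)} (hV : IsActivator f V) :
    upperDensity f V ≤ t ^ 3 + (1 - t) ^ 3 / (6 * c ^ 2) := by
  have hlim := tendsto_split_bound hc ht ht1 hf
  rw [← hlim.limsup_eq]
  refine limsup_le_limsup (Eventually.of_forall fun n => ?_) ?_ hlim.isBoundedUnder_le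
  · have hle : ⌊t * n⌋₊ ≤ n :=
      Nat.floor_le_of_le (mul_le_of_le_one_left n.cast_nonneg ht1)
    have h := card_burnSet_add_le (monotone_ceil_mul_rpow hc hf) hV ⌊t * n⌋₊ (n - ⌊t * n⌋₊)
    rw [Nat.add_sub_cancel' hle] at h
    exact div_le_div_of_nonneg_right h (by positivity)
  · refine IsCoboundedUnder.of_frequently_ge (a := 0) (Frequently.of_forall fun n => ?_)
    unfold densitySeq
    positivity

/-- for `f(n) = ⌈c n^(3/2)⌉` with `c > 0`, every activator sequence has
upper burning density at most `(1 + √6 c)⁻²`. -/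
theorem three_halves_upper_bound (c : ℝ) (hc : 0 < c) (f : ℕ → ℕ)
    (hf : ∀ n, f n = ⌈c * (n : ℝ) ^ ((3 : ℝ) / 2)⌉₊)
    (V : ℕ → Option (ℤ × ℤ)) (hV : IsActivator f V) :
    upperDensity f V ≤ ((1 + Real.sqrt 6 * c) ^ 2)⁻¹ := by
  set a := Real.sqrt 6 * c with ha
  have ha0 : 0 < a := by positivity
  have hsq : a ^ 2 = 6 * c ^ 2 := by rw [ha, mul_pow, Real.sq_sqrt (by norm_num)]
  have ht1 : (1 + a)⁻¹ ≤ 1 := inv_le_one_of_one_le₀ (by linarith)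
  refine (upperDensity_le_of_split hc (t := (1 + a)⁻¹) (by positivity) ht1 hf hV).trans_eq ?_
  rw [← hsq]
  field_simp
  ring
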